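/- Fix δ > 1. There is no Möbius pair (f,g) of complex-valued arithmetic functions, not both identically zero, such that both supports satisfy a bound of the form #{n ≤ x : n ∈ supp(f)} ≤ C_f·x/(log x)^δ and #{n ≤ x : n ∈ supp(g)} ≤ C_g·x/(log x)^δ for some real constants C_f, C_g and all x ≥ 2. In other words, the class C(δ) of sets admitting such a bound is exclusive for δ > 1. -/

import Mathlib

open Filter

open scoped Classical in
noncomputable def countIn (A : Set ℕ) (x : ℕ) : ℕ :=
  ((Finset.Icc 1 x).filter (fun n => n ∈ A)).card

/-- `(f,g)` is a Möbius pair: `f(n) = ∑_{d ∣ n} g(d)` for all positive `n`. -/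
def MobiusPair (f g : ℕ → ℂ) : Prop :=
  ∀ n : ℕ, 0 < n → f n = ∑ d ∈ n.divisors, g d

/-- `A` belongs to the class `C(δ)`: `#{n ∈ A : n ≤ x} ≤ C·x/(log x)^δ` for some
constant `C` and all real `x ≥ 2`. -/
def InClassC (δ : ℝ) (A : Set ℕ) : Prop :=
  ∃ C : ℝ, ∀ x : ℝ, 2 ≤ x → (countIn A ⌊x⌋₊ : ℝ) ≤ C * x / Real.log x ^ δ

open scoped Classical in
theorem aux_density (δ : ℝ) (hδ : 1 < δ) (A : Set ℕ) (hA : InClassC δ A) (ε : ℝ) (hε : 0 < ε) :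
    ∀ᶠ n : ℕ in atTop, (countIn A n : ℝ) ≤ ε * n := by
  obtain ⟨C, hC⟩ := hA
  have h1 : Tendsto (fun n : ℕ => Real.log (n : ℝ) ^ δ) atTop atTop :=
    (tendsto_rpow_atTop (by linarith : 0 < δ)).comp
      (Real.tendsto_log_atTop.comp tendsto_natCast_atTop_atTop)
  filter_upwards [h1.eventually_ge_atTop (C / ε), h1.eventually_gt_atTop 0,
    eventually_ge_atTop 2] with n hn hn0 hn2
  have h2 := hC n (by exact_mod_cast hn2)
  rw [Nat.floor_natCast] at h2
  refine h2.trans ?_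
  rw [div_le_iff₀ hn0]
  rw [div_le_iff₀ hε] at hn
  have : (0 : ℝ) ≤ n := Nat.cast_nonneg n
  nlinarith

open scoped Classical in
theorem aux_summable (δ : ℝ) (hδ : 1 < δ) (A : Set ℕ) (hA : InClassC δ A) :
    Summable (fun n : ℕ => if n ∈ A then (1 : ℝ) / n else 0) := by
  obtain ⟨C, hC⟩ := hA
  have hpos : ∀ n : ℕ, 0 ≤ (if n ∈ A then (1 : ℝ) / n else 0) := by
    intro n; split_ifs <;> positivity
  set u : ℕ → ℝ := fun k => 2 * C / Real.log 2 ^ δ * (1 / ((k + 1 : ℕ) : ℝ) ^ δ) with hu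
  have hl2 : 0 < Real.log 2 := Real.log_pos (by norm_num)
  have hsu : Summable u := by
    apply Summable.mul_left
    exact (summable_nat_add_iff 1).2 (Real.summable_one_div_nat_rpow.2 hδ)
  have hblock : ∀ k : ℕ, ∑ n ∈ Finset.Ico (2 ^ k) (2 ^ (k + 1)),
      (if n ∈ A then (1 : ℝ) / n else 0) ≤ u k := by
    intro k
    have h1 : ∑ n ∈ Finset.Ico (2 ^ k) (2 ^ (k + 1)), (if n ∈ A then (1 : ℝ) / n else 0)
        ≤ (countIn A (2 ^ (k + 1)) : ℝ) * (1 / 2 ^ k) := by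
      rw [← Finset.sum_filter]
      refine (Finset.sum_le_card_nsmul _ _ (1 / 2 ^ k : ℝ) ?_).trans ?_
      · intro n hn
        simp only [Finset.mem_filter, Finset.mem_Ico] at hn
        apply one_div_le_one_div_of_le (by positivity)
        exact_mod_cast hn.1.1
      · rw [nsmul_eq_mul]
        apply mul_le_mul_of_nonneg_right _ (by positivity)
        unfold countIn
        norm_cast
        apply Finset.card_le_card
        intro n hn
        simp only [Finset.mem_filter, Finset.mem_Ico, Finset.mem_Icc] at hn ⊢
        have := Nat.one_le_two_pow (n := k)
        exact ⟨⟨by omega, by omega⟩, hn.2⟩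
    have h2 := hC ((2 ^ (k + 1) : ℕ) : ℝ) (by
      have : 2 ^ 1 ≤ 2 ^ (k + 1) := Nat.pow_le_pow_right (by norm_num) (by omega)
      exact_mod_cast this)
    rw [Nat.floor_natCast] at h2
    refine h1.trans ((mul_le_mul_of_nonneg_right h2 (by positivity)).trans (le_of_eq ?_))
    rw [hu]
    push_cast
    rw [Real.log_pow, Real.mul_rpow (by positivity) hl2.le]
    push_cast
    have : (0 : ℝ) < (k + 1 : ℝ) ^ δ := by positivity
    have : (0 : ℝ) < Real.log 2 ^ δ := by positivity
    field_simp
    ring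
  have hupos : ∀ k, 0 ≤ u k := fun k => (Finset.sum_nonneg fun n _ => hpos n).trans (hblock k)
  have hind : ∀ K : ℕ, ∑ n ∈ Finset.range (2 ^ K), (if n ∈ A then (1 : ℝ) / n else 0)
      ≤ ∑ k ∈ Finset.range K, u k := by
    intro K
    induction K with
    | zero => simp
    | succ K ih =>
      rw [Finset.sum_range_succ, ← Finset.sum_range_add_sum_Ico _
        (Nat.pow_le_pow_right (by norm_num : 0 < 2) (Nat.le_succ K))]
      exact add_le_add ih (hblock K)
  refine summable_of_sum_range_le (c := ∑' k, u k) hpos fun n => ?_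
  refine le_trans ?_ ((hind n).trans (hsu.sum_le_tsum _ fun k _ => hupos k))
  apply Finset.sum_le_sum_of_subset_of_nonneg
  · exact Finset.range_subset_range.2 Nat.lt_two_pow_self.le
  · intro i _ _; exact hpos i

theorem aux_count (b d L T : ℕ) (hb : 0 < b) (hd : 0 < d) :
    (((Finset.range T).filter (fun t => b ∣ d * (1 + L * t))).card : ℝ) ≤ d * T / b + 1 := by
  rcases Finset.eq_empty_or_nonempty ((Finset.range T).filter (fun t => b ∣ d * (1 + L * t)))
    with h | ⟨t0, ht0⟩
  · rw [h]; simp; positivity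
  obtain ⟨g, a, e, hg, hco, rfl, rfl⟩ := Nat.exists_coprime' (m := b) (n := d) (Nat.gcd_pos_of_pos_left _ hb)
  have ha : 0 < a := Nat.pos_of_mul_pos_right hb
  have he : 0 < e := Nat.pos_of_mul_pos_right hd
  have key : ∀ t, a * g ∣ e * g * (1 + L * t) → a ∣ 1 + L * t := by
    intro t ht
    rw [mul_right_comm] at ht
    exact hco.dvd_of_dvd_mul_left (Nat.dvd_of_mul_dvd_mul_right hg ht)
  have h0 := key t0 (Finset.mem_filter.1 ht0).2
  have hcop : Nat.gcd a L = 1 := by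
    have h1 : Nat.gcd a L ∣ 1 + L * t0 := (Nat.gcd_dvd_left a L).trans h0
    have h2 : Nat.gcd a L ∣ L * t0 := (Nat.gcd_dvd_right a L).mul_right _
    exact Nat.dvd_one.1 ((Nat.dvd_add_left h2).1 h1)
  have hsub : (Finset.range T).filter (fun t => a * g ∣ e * g * (1 + L * t)) ⊆
      (Finset.range T).filter (fun t => t ≡ t0 [MOD a]) := by
    intro t ht
    rw [Finset.mem_filter] at ht ⊢
    refine ⟨ht.1, ?_⟩
    have h1 : 1 + L * t ≡ 1 + L * t0 [MOD a] :=
      ((Nat.modEq_zero_iff_dvd).2 (key t ht.2)).trans ((Nat.modEq_zero_iff_dvd).2 h0).symm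
    exact Nat.ModEq.cancel_left_of_coprime hcop (Nat.ModEq.add_left_cancel' 1 h1)
  have hle : (((Finset.range T).filter (fun t => a * g ∣ e * g * (1 + L * t))).card : ℝ) ≤
      Nat.count (fun t => t ≡ t0 [MOD a]) T := by
    rw [Nat.count_eq_card_filter_range]
    exact_mod_cast Finset.card_le_card hsub
  have hc : (Nat.count (fun t => t ≡ t0 [MOD a]) T : ℝ) ≤ T / a + 1 := by
    have h := Nat.count_modEq_card T ha t0
    rw [h]
    have : ((T / a : ℕ) : ℝ) ≤ T / a := Nat.cast_div_le
    push_cast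
    split_ifs <;> push_cast <;> linarith
  refine hle.trans (hc.trans ?_)
  have ha' : (0 : ℝ) < a := by exact_mod_cast ha
  have hg' : (0 : ℝ) < g := by exact_mod_cast hg
  have he' : (1 : ℝ) ≤ e := by exact_mod_cast he
  have hT : (0 : ℝ) ≤ T := Nat.cast_nonneg T
  push_cast
  have : (e * g * T / (a * g) : ℝ) = e * (T / a) := by field_simp
  rw [this]
  have : (0 : ℝ) ≤ T / a := by positivity
  nlinarith

open scoped Classical in
/-- For `δ > 1`, the class `C(δ)` is exclusive: there is no nonzero Möbius pair
`(f,g)` with both `supp f` and `supp g` in `C(δ)`. -/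
theorem aux_main (δ : ℝ) (hδ : 1 < δ) (f g : ℕ → ℂ) (hfg : MobiusPair f g)
    (hne : ∃ n : ℕ, 0 < n ∧ g n ≠ 0)
    (hf : InClassC δ {n : ℕ | f n ≠ 0}) (hg : InClassC δ {n : ℕ | g n ≠ 0}) : False := by
  obtain ⟨hd, hgd⟩ := Nat.find_spec hne
  have hmin : ∀ m, 0 < m → m < Nat.find hne → g m = 0 := by
    intro m hm hlt
    by_contra hc
    exact Nat.find_min hne hlt ⟨hm, hc⟩
  generalize Nat.find hne = d at hd hgd hmin
  have hd' : (0 : ℝ) < d := by exact_mod_cast hd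
  have hsum := aux_summable δ hδ _ hg
  set w : ℕ → ℝ := fun n => if n ∈ {n : ℕ | g n ≠ 0} then (1 : ℝ) / n else 0 with hw
  -- choose the cut-off
  obtain ⟨N, hNd, hN⟩ : ∃ N : ℕ, d ≤ N ∧ ∀ M : ℕ, ∑ b ∈ Finset.Ioc N M, w b ≤ 1 / (2 * d) := by
    have hlt : ∀ᶠ N : ℕ in atTop, ∑' k, w (k + N) < 1 / (2 * d) :=
      (tendsto_sum_nat_add w).eventually_lt_const (by positivity)
    obtain ⟨N, h1, h2⟩ := ((hlt.and (eventually_ge_atTop d))).exists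
    have hwpos : ∀ n, 0 ≤ w n := by
      intro n; simp only [hw]; split_ifs <;> positivity
    refine ⟨N, h2, fun M => le_trans ?_ h1.le⟩
    have : ∑ b ∈ Finset.Ioc N M, w b ≤ ∑ b ∈ Finset.Ico N (M + 1), w b := by
      apply Finset.sum_le_sum_of_subset_of_nonneg
      · intro b hb
        rw [Finset.mem_Ioc] at hb
        rw [Finset.mem_Ico]; omega
      · intro i _ _; exact hwpos i
    refine this.trans ?_
    rw [Finset.sum_Ico_eq_sum_range]
    have hs : Summable (fun k => w (k + N)) := by
      have hsw : Summable w := by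
        refine hsum.congr fun n => ?_
        simp only [hw]
        congr
      exact (summable_nat_add_iff N).2 hsw
    refine le_trans (le_of_eq ?_) (hs.sum_le_tsum (Finset.range (M + 1 - N)) fun k _ => hwpos _)
    exact Finset.sum_congr rfl fun i _ => by rw [add_comm]
  set L := N.factorial with hL
  have hLpos : 0 < L := Nat.factorial_pos N
  have hLR : (1 : ℝ) ≤ L := by exact_mod_cast hLpos
  -- inequality for every T
  have hT : ∀ T : ℕ, (T : ℝ) ≤ T / 2 + countIn {n | g n ≠ 0} (d * (1 + L * T))
      + countIn {n | f n ≠ 0} (d * (1 + L * T)) := by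
    intro T
    set M := d * (1 + L * T) with hM
    set F := (Finset.range T).filter (fun t => f (d * (1 + L * t)) ≠ 0) with hF
    set B := (Finset.Ioc N M).filter (fun b => b ∈ {n | g n ≠ 0}) with hB
    set E : ℕ → Finset ℕ := fun b => (Finset.range T).filter (fun t => b ∣ d * (1 + L * t))
    have hcover : Finset.range T ⊆ B.biUnion E ∪ F := by
      intro t ht
      by_contra hc
      simp only [Finset.mem_union, Finset.mem_biUnion, not_or, not_exists, not_and] at hc
      obtain ⟨hc1, hc2⟩ := hc
      apply hc2
      rw [hF, Finset.mem_filter]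
      refine ⟨ht, ?_⟩
      have hnpos : 0 < d * (1 + L * t) := by positivity
      rw [hfg _ hnpos, Finset.sum_eq_single d]
      · exact hgd
      · intro b hb hbd
        by_contra hgb
        have hbdvd := Nat.dvd_of_mem_divisors hb
        have hbpos := Nat.pos_of_mem_divisors hb
        by_cases hbN : b ≤ N
        · have h1 : b ∣ L := Nat.dvd_factorial hbpos hbN
          have h2 : b ∣ d := by
            have h3 : b ∣ d * (L * t) := (h1.mul_right t).mul_left d
            rw [mul_add, mul_one] at hbdvd
            exact (Nat.dvd_add_left h3).1 hbdvd
          have h4 := Nat.le_of_dvd hd h2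
          exact hgb (hmin b hbpos (lt_of_le_of_ne h4 hbd))
        · refine hc1 b ?_ (Finset.mem_filter.2 ⟨ht, hbdvd⟩)
          rw [hB, Finset.mem_filter, Finset.mem_Ioc]
          refine ⟨⟨by omega, (Nat.le_of_dvd hnpos hbdvd).trans ?_⟩, hgb⟩
          rw [hM]
          have := (Finset.mem_range.1 ht).le
          gcongr
      · intro h
        exact absurd (Nat.mem_divisors.2 ⟨dvd_mul_right _ _, hnpos.ne'⟩) h
    have h1 : (T : ℝ) ≤ (∑ b ∈ B, ((E b).card : ℝ)) + F.card := by
      have := (Finset.card_le_card hcover).trans ((Finset.card_union_le _ _).trans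
        (Nat.add_le_add_right Finset.card_biUnion_le _))
      rw [Finset.card_range] at this
      exact_mod_cast this
    have h2 : (F.card : ℝ) ≤ countIn {n | f n ≠ 0} M := by
      unfold countIn
      norm_cast
      apply Finset.card_le_card_of_injOn (fun t => d * (1 + L * t))
      · intro t ht
        have ht' := Finset.mem_filter.1 (Finset.mem_coe.1 ht)
        refine Finset.mem_coe.2 (Finset.mem_filter.2 ⟨Finset.mem_Icc.2 ⟨?_, ?_⟩, ht'.2⟩)
        · show 0 < d * (1 + L * t)
          positivity
        · have := (Finset.mem_range.1 ht'.1).le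
          show d * (1 + L * t) ≤ d * (1 + L * T)
          gcongr
      · intro s _ t _ hst
        have h3 := Nat.eq_of_mul_eq_mul_left hd hst
        exact Nat.eq_of_mul_eq_mul_left hLpos (Nat.add_left_cancel h3)
    have h3 : (B.card : ℝ) ≤ countIn {n | g n ≠ 0} M := by
      unfold countIn
      norm_cast
      apply Finset.card_le_card
      intro b hb
      simp only [hB, Finset.mem_filter, Finset.mem_Ioc, Finset.mem_Icc] at hb ⊢
      exact ⟨⟨by omega, hb.1.2⟩, hb.2⟩
    have h4 : ∑ b ∈ B, ((E b).card : ℝ) ≤ ∑ b ∈ B, ((d * T : ℝ) * (1 / b) + 1) := by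
      apply Finset.sum_le_sum
      intro b hb
      simp only [hB, Finset.mem_filter, Finset.mem_Ioc] at hb
      have := aux_count b d L T (by omega) hd
      rw [mul_one_div]
      exact this
    have h5 : ∑ b ∈ B, ((d * T : ℝ) * (1 / b) + 1) ≤ T / 2 + B.card := by
      rw [Finset.sum_add_distrib, ← Finset.mul_sum, hB, Finset.sum_filter]
      have h6 := mul_le_mul_of_nonneg_left (hN M) (by positivity : (0 : ℝ) ≤ d * T)
      have h7 : (d * T : ℝ) * (1 / (2 * d)) = T / 2 := by field_simp
      rw [h7] at h6
      simp only [Finset.sum_const, nsmul_eq_mul, mul_one]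
      exact add_le_add_left h6 _
    linarith
  -- densities
  have hε : (0 : ℝ) < 1 / (16 * (d * L)) := by positivity
  have hMt : Tendsto (fun T : ℕ => d * (1 + L * T)) atTop atTop := by
    apply tendsto_atTop_mono _ tendsto_id
    intro T
    show T ≤ d * (1 + L * T)
    nlinarith [Nat.mul_le_mul hd (Nat.mul_le_mul_right T hLpos)]
  obtain ⟨T, ⟨h1, h2⟩, h3⟩ := (((hMt.eventually (aux_density δ hδ _ hf _ hε)).and
    (hMt.eventually (aux_density δ hδ _ hg _ hε))).and (eventually_ge_atTop 1)).exists
  have h4 := hT T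
  have hT1 : (1 : ℝ) ≤ T := by exact_mod_cast h3
  have h5 : (1 / (16 * (d * L)) : ℝ) * ((d * (1 + L * T) : ℕ) : ℝ) ≤ T / 8 := by
    push_cast
    rw [one_div_mul_eq_div, div_le_iff₀ (by positivity)]
    have : (1 : ℝ) ≤ L * T := by nlinarith
    nlinarith
  linarith

/-- For `δ > 1`, the class `C(δ)` is exclusive: there is no nonzero Möbius pair
`(f,g)` with both `supp f` and `supp g` in `C(δ)`. -/
theorem classC_exclusive_of_one_lt (δ : ℝ) (hδ : 1 < δ) :
    ¬ ∃ f g : ℕ → ℂ, MobiusPair f g ∧ (∃ n : ℕ, 0 < n ∧ (f n ≠ 0 ∨ g n ≠ 0)) ∧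
      InClassC δ {n : ℕ | f n ≠ 0} ∧ InClassC δ {n : ℕ | g n ≠ 0} := by
  rintro ⟨f, g, hfg, ⟨n, hn, hor⟩, hf, hg⟩
  refine aux_main δ hδ f g hfg ?_ hf hg
  rcases hor with h | h
  · rw [hfg n hn] at h
    obtain ⟨b, hb, hgb⟩ := Finset.exists_ne_zero_of_sum_ne_zero h
    exact ⟨b, Nat.pos_of_mem_divisors hb, hgb⟩
  · exact ⟨n, hn, h⟩
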